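/- For every m≥4, B((t_m+2t_{m-1}+t_{m-2}−3)/2) − B((t_m+t_{m-2}−3)/2) = (m/22)(−5t_m+14t_{m-1}+4t_{m-2}) + (1/44)(67t_m−166t_{m-1}+5t_{m-2}) + 1/4. (The left-hand side is the number of square occurrences in 𝕋 whose last letter lies at a position in the interval [(t_m+t_{m-2}−1)/2, (t_m+2t_{m-1}+t_{m-2}−3)/2].) -/

import Mathlib

/-- The three-letter alphabet of the Tribonacci word. -/
inductive TLetter : Type
  | a | b | c
deriving DecidableEq

/-- The Tribonacci substitution σ(a)=ab, σ(b)=ac, σ(c)=a. -/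
def tsubst : TLetter → List TLetter
  | .a => [.a, .b]
  | .b => [.a, .c]
  | .c => [.a]

/-- `Tword m = σ^m(a)`, the m-th finite Tribonacci word. -/
def Tword : ℕ → List TLetter
  | 0 => [.a]
  | n + 1 => (Tword n).flatMap tsubst

/-- The prefix 𝕋[1,n] of the Tribonacci word of length n
(each `Tword n` is a prefix of the next and has length ≥ n). -/
def TPrefix (n : ℕ) : List TLetter := (Tword n).take n

/-- A word is a factor of the Tribonacci word 𝕋. -/
def IsFactorT (w : List TLetter) : Prop := ∃ m, w <:+: Tword m

/-- `tribAux i = t_{i-2}`: Tribonacci numbers, shifted so that the index is a natural. -/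
def tribAux : ℕ → ℕ
  | 0 => 0
  | 1 => 1
  | 2 => 1
  | n + 3 => tribAux (n + 2) + tribAux (n + 1) + tribAux n

/-- The Tribonacci numbers `t m` for `m : ℤ`: t₋₂=0, t₋₁=1, t₀=1,
`t m = t (m-1) + t (m-2) + t (m-3)` for m ≥ 1. (Junk value 0 below -2.) -/
def t (m : ℤ) : ℕ := tribAux (m + 2).toNat

/-- Kernel numbers: k₀=0, k₁=k₂=1, `k m = k (m-1) + k (m-2) + k (m-3) - 1` for m ≥ 3. -/
def kAux : ℕ → ℕ
  | 0 => 0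
  | 1 => 1
  | 2 => 1
  | n + 3 => kAux (n + 2) + kAux (n + 1) + kAux n - 1

def kker (m : ℤ) : ℕ := kAux m.toNat

/-- `A n`: the number of distinct nonempty words w with ww a factor of 𝕋[1,n]. -/
noncomputable def A (n : ℕ) : ℕ := Nat.card {w : List TLetter // w ≠ [] ∧ (w ++ w) <:+: TPrefix n}

/-- `B n`: the number of occurrences of squares in 𝕋[1,n], i.e. of pairs (w,i) with
w nonempty, i ≥ 1, ww occurring in 𝕋 at position i and i + 2|w| - 1 ≤ n. -/
noncomputable def B (n : ℕ) : ℕ :=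
  Nat.card {p : List TLetter × ℕ // p.1 ≠ [] ∧ 1 ≤ p.2 ∧
    p.2 + 2 * p.1.length - 1 ≤ n ∧ (p.1 ++ p.1) <+: (TPrefix n).drop (p.2 - 1)}

/-- `C n`: the number of distinct nonempty words w with www a factor of 𝕋[1,n]. -/
noncomputable def C (n : ℕ) : ℕ := Nat.card {w : List TLetter // w ≠ [] ∧ (w ++ w ++ w) <:+: TPrefix n}

/-- `D n`: the number of occurrences of cubes in 𝕋[1,n], i.e. of pairs (w,i) with
w nonempty, i ≥ 1, www occurring in 𝕋 at position i and i + 3|w| - 1 ≤ n. -/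
noncomputable def D (n : ℕ) : ℕ :=
  Nat.card {p : List TLetter × ℕ // p.1 ≠ [] ∧ 1 ≤ p.2 ∧
    p.2 + 3 * p.1.length - 1 ≤ n ∧ (p.1 ++ p.1 ++ p.1) <+: (TPrefix n).drop (p.2 - 1)}

/-- The letter at the (0-based) position `n` of the Tribonacci word. -/
def tribLetter (n : ℕ) : TLetter := (Tword n).getD n .a

/-- The prefix of length `n`, as a list of letters. -/
def letterPrefix (n : ℕ) : List TLetter := (List.range n).map tribLetter

/-- The length of the image of the prefix of length `n` under the substitution. -/
def substLength (n : ℕ) : ℕ := ((letterPrefix n).flatMap tsubst).length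

@[simp] lemma length_letterPrefix (n : ℕ) : (letterPrefix n).length = n := by
  simp [letterPrefix]

lemma letterPrefix_succ (n : ℕ) : letterPrefix (n + 1) = letterPrefix n ++ [tribLetter n] := by
  simp [letterPrefix, List.range_succ]

lemma Tword_prefix_succ (n : ℕ) : Tword n <+: Tword (n + 1) := by
  induction n with
  | zero => exact ⟨[.b], rfl⟩
  | succ n ih =>
    obtain ⟨s, hs⟩ := ih
    refine ⟨s.flatMap tsubst, ?_⟩
    conv_rhs => rw [Tword, ← hs, List.flatMap_append]
    rfl

lemma Tword_prefix {m n : ℕ} (h : m ≤ n) : Tword m <+: Tword n := by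
  induction n, h using Nat.le_induction with
  | base => exact List.prefix_rfl
  | succ n _ ih => exact ih.trans (Tword_prefix_succ n)

lemma le_length_flatMap_tsubst (l : List TLetter) : l.length ≤ (l.flatMap tsubst).length := by
  induction l with
  | nil => simp
  | cons x l ih => cases x <;> simp [tsubst] at ih ⊢ <;> omega

lemma lt_length_Tword (n : ℕ) : n < (Tword n).length := by
  have key : ∀ n, n < (Tword n).length ∧ ∃ l, Tword n = .a :: l := by
    intro n
    induction n with
    | zero => exact ⟨by simp [Tword], [], rfl⟩
    | succ n ih =>
      obtain ⟨h, l, hl⟩ := ih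
      have h2 := le_length_flatMap_tsubst l
      rw [hl] at h
      refine ⟨?_, .b :: l.flatMap tsubst, ?_⟩
      · rw [Tword, hl]
        simp [tsubst] at h h2 ⊢
        omega
      · rw [Tword, hl]
        simp [tsubst]
  exact (key n).1

lemma Tword_getElem? {m i : ℕ} (h : i < (Tword m).length) :
    (Tword m)[i]? = some (tribLetter i) := by
  have hi := lt_length_Tword i
  have h2 : (Tword i)[i]? = some (tribLetter i) := by
    simp [tribLetter, List.getElem?_eq_getElem hi]
  rcases le_total m i with hmi | hmi
  · obtain ⟨s, hs⟩ := Tword_prefix hmi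
    rw [← hs, List.getElem?_append_left h] at h2
    exact h2
  · obtain ⟨s, hs⟩ := Tword_prefix hmi
    rw [← hs, List.getElem?_append_left hi]
    exact h2

lemma letterPrefix_getElem? {n i : ℕ} (h : i < n) :
    (letterPrefix n)[i]? = some (tribLetter i) := by
  simp [letterPrefix, h]

lemma Tword_take {m n : ℕ} (h : n ≤ (Tword m).length) : (Tword m).take n = letterPrefix n := by
  apply List.ext_getElem?
  intro i
  rw [List.getElem?_take]
  by_cases hi : i < n
  · rw [if_pos hi, Tword_getElem? (hi.trans_le h), letterPrefix_getElem? hi]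
  · rw [if_neg hi, List.getElem?_eq_none (by simpa using hi)]

lemma TPrefix_eq (n : ℕ) : TPrefix n = letterPrefix n :=
  Tword_take (lt_length_Tword n).le

lemma flatMap_letterPrefix (n : ℕ) :
    (letterPrefix n).flatMap tsubst = letterPrefix (substLength n) := by
  have h : letterPrefix n <+: Tword n := by
    rw [← Tword_take (lt_length_Tword n).le]
    exact List.take_prefix _ _
  obtain ⟨s, hs⟩ := h
  have h2 : (letterPrefix n).flatMap tsubst <+: Tword (n + 1) :=
    ⟨s.flatMap tsubst, by rw [Tword, ← List.flatMap_append, hs]⟩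
  rw [List.prefix_iff_eq_take.1 h2]
  exact Tword_take h2.length_le

@[simp] lemma substLength_zero : substLength 0 = 0 := rfl

lemma letterPrefix_substLength_succ (n : ℕ) :
    letterPrefix (substLength (n + 1)) = letterPrefix (substLength n) ++ tsubst (tribLetter n) := by
  rw [← flatMap_letterPrefix, ← flatMap_letterPrefix, letterPrefix_succ, List.flatMap_append]
  simp

lemma substLength_succ (n : ℕ) :
    substLength (n + 1) = substLength n + (tsubst (tribLetter n)).length := by
  simpa using congrArg List.length (letterPrefix_substLength_succ n)

lemma tribLetter_substLength_add (n j : ℕ) (hj : j < (tsubst (tribLetter n)).length) :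
    (tsubst (tribLetter n))[j]? = some (tribLetter (substLength n + j)) := by
  have h := letterPrefix_getElem? (n := substLength (n + 1)) (i := substLength n + j)
    (by rw [substLength_succ]; omega)
  rw [letterPrefix_substLength_succ, List.getElem?_append_right (by simp)] at h
  simpa using h

@[simp] lemma tribLetter_zero : tribLetter 0 = .a := rfl

lemma tribLetter_substLength (n : ℕ) : tribLetter (substLength n) = .a := by
  have h := tribLetter_substLength_add n 0 (by cases tribLetter n <;> simp [tsubst])
  cases hn : tribLetter n <;> simp [hn, tsubst] at h <;> exact h.symm

lemma substLength_succ_of_ne {n : ℕ} (h : tribLetter n ≠ .c) :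
    substLength (n + 1) = substLength n + 2 := by
  rw [substLength_succ]
  cases hn : tribLetter n <;> simp_all [tsubst]

lemma substLength_succ_of_eq {n : ℕ} (h : tribLetter n = .c) :
    substLength (n + 1) = substLength n + 1 := by
  rw [substLength_succ, h]
  simp [tsubst]

/-- The cyclic successor of a letter. -/
def TLetter.next : TLetter → TLetter
  | .a => .b
  | .b => .c
  | .c => .a

lemma TLetter.next_injective : Function.Injective TLetter.next := by
  intro x y h
  cases x <;> cases y <;> simp_all [TLetter.next]

lemma tribLetter_substLength_add_one (n : ℕ) :
    tribLetter (substLength n + 1) = (tribLetter n).next := by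
  cases hn : tribLetter n with
  | c => rw [← substLength_succ_of_eq hn, tribLetter_substLength]; rfl
  | a =>
    have h := tribLetter_substLength_add n 1 (by simp [hn, tsubst])
    simp [hn, tsubst] at h
    exact h.symm
  | b =>
    have h := tribLetter_substLength_add n 1 (by simp [hn, tsubst])
    simp [hn, tsubst] at h
    exact h.symm

lemma tribLetter_substLength_succ_sub_one (n : ℕ) :
    tribLetter (substLength (n + 1) - 1) = (tribLetter n).next := by
  by_cases hn : tribLetter n = .c
  · rw [substLength_succ_of_eq hn, hn]
    exact tribLetter_substLength n
  · rw [substLength_succ_of_ne hn]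
    exact tribLetter_substLength_add_one n

lemma substLength_strictMono : StrictMono substLength := by
  apply strictMono_nat_of_lt_succ
  intro n
  by_cases hn : tribLetter n = .c
  · rw [substLength_succ_of_eq hn]; omega
  · rw [substLength_succ_of_ne hn]; omega

lemma exists_substLength (x : ℕ) :
    ∃ i, x = substLength i ∨ (x = substLength i + 1 ∧ tribLetter i ≠ .c) := by
  induction x with
  | zero => exact ⟨0, Or.inl rfl⟩
  | succ x ih =>
    obtain ⟨i, rfl | ⟨rfl, hi⟩⟩ := ih
    · by_cases hi : tribLetter i = .c
      · exact ⟨i + 1, Or.inl (substLength_succ_of_eq hi).symm⟩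
      · exact ⟨i, Or.inr ⟨rfl, hi⟩⟩
    · exact ⟨i + 1, Or.inl (substLength_succ_of_ne hi).symm⟩

lemma tribLetter_succ_of_ne {x : ℕ} (h : tribLetter x ≠ .a) : tribLetter (x + 1) = .a := by
  obtain ⟨i, rfl | ⟨rfl, hi⟩⟩ := exists_substLength x
  · exact absurd (tribLetter_substLength i) h
  · rw [add_assoc, ← substLength_succ_of_ne hi, tribLetter_substLength]

/-- The length of the image of a letter under the `n`-th power of the substitution. -/
def letterLength (n : ℕ) : TLetter → ℕ
  | .a => tribAux (n + 2)
  | .b => tribAux (n + 1) + tribAux n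
  | .c => tribAux (n + 1)

/-- The lengths `0, 1, 3, 7, 14, 27, …` of the palindromic prefixes of the Tribonacci word. -/
def palLength : ℕ → ℕ
  | 0 => 0
  | n + 1 => substLength (palLength n) + 1

lemma tribAux_add_three (n : ℕ) :
    tribAux (n + 3) = tribAux (n + 2) + tribAux (n + 1) + tribAux n := rfl

lemma iterate_substLength_succ (n i : ℕ) :
    substLength^[n] (i + 1) = substLength^[n] i + letterLength n (tribLetter i) := by
  induction n generalizing i with
  | zero => cases tribLetter i <;> simp [letterLength, tribAux]
  | succ n ih =>
    rw [Function.iterate_succ_apply, Function.iterate_succ_apply]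
    cases hi : tribLetter i with
    | c =>
      rw [substLength_succ_of_eq hi, ih, tribLetter_substLength]
      simp [letterLength]
    | a =>
      rw [substLength_succ_of_ne (by simp [hi]), ← one_add_one_eq_two, ← add_assoc, ih, ih,
        tribLetter_substLength, tribLetter_substLength_add_one, hi]
      have := tribAux_add_three n
      simp only [letterLength, TLetter.next, add_assoc, Nat.reduceAdd] at this ⊢
      omega
    | b =>
      rw [substLength_succ_of_ne (by simp [hi]), ← one_add_one_eq_two, ← add_assoc, ih, ih,
        tribLetter_substLength, tribLetter_substLength_add_one, hi]
      simp only [letterLength, TLetter.next, add_assoc, Nat.reduceAdd]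

lemma iterate_substLength_strictMono (n : ℕ) : StrictMono substLength^[n] :=
  substLength_strictMono.iterate n

@[simp] lemma iterate_substLength_zero (n : ℕ) : substLength^[n] 0 = 0 :=
  Function.iterate_fixed substLength_zero n

lemma iterate_substLength_one (n : ℕ) : substLength^[n] 1 = tribAux (n + 2) := by
  simpa [letterLength] using iterate_substLength_succ n 0

lemma substLength_add_of_agree {x l : ℕ} (h : ∀ r < l, tribLetter (x + r) = tribLetter r) :
    ∀ r ≤ l, substLength (x + r) = substLength x + substLength r := by
  intro r
  induction r with
  | zero => simp
  | succ r ih =>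
    intro hr
    rw [← add_assoc, substLength_succ, substLength_succ, h r (by omega), ih (by omega)]
    omega

lemma tribLetter_iterate_add (n i : ℕ) :
    ∀ r < palLength n, tribLetter (substLength^[n] i + r) = tribLetter r := by
  induction n with
  | zero => intro r hr; simp [palLength] at hr
  | succ n ih =>
    intro r hr
    rw [Function.iterate_succ_apply']
    simp only [palLength] at hr
    obtain ⟨q, rfl | ⟨rfl, hq⟩⟩ := exists_substLength r
    · have hq : q ≤ palLength n :=
        substLength_strictMono.le_iff_le.1 (by omega)
      rw [← substLength_add_of_agree ih q hq, tribLetter_substLength, tribLetter_substLength]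
    · have hq : q < palLength n :=
        substLength_strictMono.lt_iff_lt.1 (by omega)
      rw [← add_assoc, ← substLength_add_of_agree ih q hq.le, tribLetter_substLength_add_one,
        tribLetter_substLength_add_one, ih q hq]

lemma substLength_iterate_add (n i : ℕ) {r : ℕ} (hr : r ≤ palLength n) :
    substLength (substLength^[n] i + r) = substLength^[n + 1] i + substLength r := by
  rw [Function.iterate_succ_apply']
  exact substLength_add_of_agree (tribLetter_iterate_add n i) r hr

lemma palLength_add (n k : ℕ) :
    palLength (n + k) = substLength^[n] (palLength k) + palLength n := by
  induction n with
  | zero => simp [palLength]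
  | succ n ih =>
    rw [add_right_comm, palLength, ih, substLength_iterate_add _ _ le_rfl, palLength, add_assoc]

lemma palLength_succ (n : ℕ) : palLength (n + 1) = palLength n + tribAux (n + 2) := by
  rw [palLength_add n 1]
  simp [palLength, iterate_substLength_one, add_comm]

lemma palLength_strictMono : StrictMono palLength :=
  strictMono_nat_of_lt_succ fun n => by
    rw [palLength]
    exact Nat.lt_succ_of_le substLength_strictMono.le_apply

lemma two_mul_palLength (n : ℕ) : 2 * palLength n + 3 = tribAux (n + 3) + tribAux (n + 1) := by
  induction n with
  | zero => simp [palLength, tribAux]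
  | succ n ih =>
    have h := palLength_succ n
    have h1 := tribAux_add_three n
    have h2 := tribAux_add_three (n + 1)
    simp only [add_assoc, Nat.reduceAdd] at h h1 h2 ih ⊢
    omega

lemma tribAux_succ_pos (n : ℕ) : 0 < tribAux (n + 1) := by
  induction n using Nat.strong_induction_on with
  | _ n ih =>
    match n, ih with
    | 0, _ => simp [tribAux]
    | 1, _ => simp [tribAux]
    | n + 2, ih =>
      have := ih (n + 1) (by omega)
      rw [add_assoc, one_add_one_eq_two] at this
      rw [tribAux_add_three]
      omega

lemma tribAux_add_le (n : ℕ) : tribAux (n + 1) + tribAux n ≤ tribAux (n + 2) := by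
  cases n with
  | zero => simp [tribAux]
  | succ n =>
    have := tribAux_add_three n
    simp only [add_assoc, Nat.reduceAdd] at this ⊢
    omega

lemma tribAux_le_two_mul (n : ℕ) : tribAux (n + 2) ≤ 2 * tribAux (n + 1) := by
  cases n with
  | zero => simp [tribAux]
  | succ n =>
    have h := tribAux_add_three n
    have h1 := tribAux_add_le n
    simp only [add_assoc, Nat.reduceAdd] at h h1 ⊢
    omega

/-- The positions `x` and `x + p` carry the same letter. -/
def Agree (p x : ℕ) : Prop := tribLetter x = tribLetter (x + p)

/-- The window `[x, x + l)` is a maximal window of positions at which `p` is a local period. -/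
structure MaximalRun (p x l : ℕ) : Prop where
  agree : ∀ r < l, Agree p (x + r)
  right : ¬ Agree p (x + l)
  left : ∀ y, x = y + 1 → ¬ Agree p y

lemma MaximalRun.le_of_agree {p x l y q : ℕ} (h : MaximalRun p x l) (hy : y ≤ x + l)
    (hq : ∀ r < q, Agree p (y + r)) : y + q ≤ x + l := by
  by_contra! hlt
  apply h.right
  have := hq (x + l - y) (by omega)
  rwa [Nat.add_sub_cancel' hy] at this

lemma MaximalRun.ext {p x l x' l' y : ℕ} (h : MaximalRun p x l) (h' : MaximalRun p x' l')
    (h1 : x ≤ y) (h2 : y < x + l) (h1' : x' ≤ y) (h2' : y < x' + l') : x = x' ∧ l = l' := by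
  have key : ∀ {x l x' l' : ℕ}, MaximalRun p x l → MaximalRun p x' l' → y < x + l → x' ≤ y →
      x' ≤ x := by
    intro x l x' l' h h' h2 h1'
    by_contra! hlt
    refine h'.left (x' - 1) (by omega) ?_
    have := h.agree (x' - 1 - x) (by omega)
    rwa [Nat.add_sub_cancel' (by omega)] at this
  have hx : x = x' := le_antisymm (key h' h h2' h1) (key h h' h2 h1')
  subst hx
  exact ⟨rfl, by
    have := h.le_of_agree (by omega) h'.agree
    have := h'.le_of_agree (by omega) h.agree
    omega⟩

lemma maximalRun_iterate (n : ℕ) {i j : ℕ} (hij : i < j) (hne : tribLetter i ≠ tribLetter j)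
    (hleft : ∀ y d, i = y + 1 → j = y + 1 + d → ¬ Agree d y) :
    MaximalRun (substLength^[n] j - substLength^[n] i) (substLength^[n] i) (palLength n) := by
  have hle : substLength^[n] i ≤ substLength^[n] j :=
    (iterate_substLength_strictMono n).monotone hij.le
  have hright : ∀ n, tribLetter (substLength^[n] i + palLength n) ≠
      tribLetter (substLength^[n] j + palLength n) := by
    intro n
    induction n with
    | zero => simpa [palLength] using hne
    | succ n ih =>
      rw [palLength, ← add_assoc, ← add_assoc, ← substLength_iterate_add _ _ le_rfl,
        ← substLength_iterate_add _ _ le_rfl, tribLetter_substLength_add_one,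
        tribLetter_substLength_add_one]
      exact fun h => ih (TLetter.next_injective h)
  have hl : 0 < i → ∀ n, tribLetter (substLength^[n] i - 1) ≠
      tribLetter (substLength^[n] j - 1) := by
    intro hi n
    induction n with
    | zero =>
      have := hleft (i - 1) (j - i) (by omega) (by omega)
      simpa [Agree, show i - 1 + (j - i) = j - 1 by omega] using this
    | succ n ih =>
      have e : ∀ k, 0 < k → tribLetter (substLength^[n + 1] k - 1) =
          (tribLetter (substLength^[n] k - 1)).next := by
        intro k hk
        have hk : 0 < substLength^[n] k :=
          hk.trans_le (iterate_substLength_strictMono n).le_apply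
        rw [Function.iterate_succ_apply', ← tribLetter_substLength_succ_sub_one,
          Nat.sub_add_cancel hk]
      rw [e i hi, e j (by omega)]
      exact fun h => ih (TLetter.next_injective h)
  refine ⟨fun r hr => ?_, ?_, fun y hy => ?_⟩
  · rw [Agree, tribLetter_iterate_add n i r hr, add_right_comm, Nat.add_sub_cancel' hle,
      tribLetter_iterate_add n j r hr]
  · rw [Agree, add_right_comm, Nat.add_sub_cancel' hle]
    exact hright n
  · have hi : 0 < i := by
      by_contra! h0
      simp [Nat.le_zero.1 h0] at hy
    have := hl hi n
    rwa [hy, Nat.add_sub_cancel, show substLength^[n] j - 1 = y +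
      (substLength^[n] j - (y + 1)) by omega, ← hy] at this

lemma lt_substLength {v : ℕ} (hv : 0 < v) : v < substLength v := by
  induction v, hv using Nat.le_induction with
  | base => decide
  | succ v _ ih => exact (Nat.succ_le_of_lt ih).trans_lt (substLength_strictMono v.lt_succ_self)

/-- Every pair of positions with equal letters lies in the iterated image of a pair of positions
with no agreement at or directly before it. -/
lemma exists_iterate (x y : ℕ) (hxy : x < y) (h : tribLetter x = tribLetter y) :
    ∃ n i j, i < j ∧ tribLetter i ≠ tribLetter j ∧
      (∀ u d, i = u + 1 → j = u + 1 + d → ¬ Agree d u) ∧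
      ∃ r < palLength n, x = substLength^[n] i + r ∧ y = substLength^[n] j + r := by
  induction y using Nat.strong_induction_on generalizing x with
  | _ y ih =>
    have lift : ∀ u v, u < v → v < y → tribLetter u = tribLetter v →
        ∃ n i j, i < j ∧ tribLetter i ≠ tribLetter j ∧
        (∀ u d, i = u + 1 → j = u + 1 + d → ¬ Agree d u) ∧
        ∃ r < palLength n, u = substLength^[n] i + r ∧ v = substLength^[n] j + r :=
      fun u v huv hv he => ih v hv u huv he
    obtain ⟨u, hu⟩ := exists_substLength x
    obtain ⟨v, hv⟩ := exists_substLength y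
    have hvy : v ≤ substLength v := substLength_strictMono.le_apply
    have huv : u ≤ v := by
      by_contra! hlt
      have := substLength_strictMono hlt
      omega
    rcases hu with rfl | ⟨rfl, hu⟩ <;> rcases hv with rfl | ⟨rfl, hv⟩
    · have huv : u < v := substLength_strictMono.lt_iff_lt.1 hxy
      by_cases hprev : ∃ w d, u = w + 1 ∧ v = w + 1 + d ∧ Agree d w
      · obtain ⟨w, d, rfl, rfl, hw⟩ := hprev
        obtain ⟨n, i, j, hij, hne, hl, r, hr, e1, e2⟩ := lift w (w + d) (by omega) (by omega) hw
        refine ⟨n + 1, i, j, hij, hne, hl, substLength (r + 1), ?_, ?_, ?_⟩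
        · rw [palLength]
          exact Nat.lt_succ_of_le (substLength_strictMono.monotone hr)
        · rw [← substLength_iterate_add _ _ hr, e1]
          rfl
        · rw [← substLength_iterate_add _ _ hr]
          congr 1
          omega
      · by_cases huv' : tribLetter u = tribLetter v
        · have hvy : v < substLength v := lt_substLength (by omega)
          obtain ⟨n, i, j, hij, hne, hl, r, hr, e1, e2⟩ := lift u v huv hvy huv'
          refine ⟨n + 1, i, j, hij, hne, hl, substLength r, ?_, ?_, ?_⟩
          · rw [palLength]
            exact Nat.lt_succ_of_le (substLength_strictMono.monotone hr.le)
          · rw [← substLength_iterate_add _ _ hr.le, ← e1]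
          · rw [← substLength_iterate_add _ _ hr.le, ← e2]
        · exact ⟨1, u, v, huv, huv', fun w d h1 h2 h3 => hprev ⟨w, d, h1, h2, h3⟩, 0,
            by simp [palLength], by simp, by simp⟩
    · rw [tribLetter_substLength, tribLetter_substLength_add_one] at h
      cases hvl : tribLetter v <;> rw [hvl] at h hv <;> simp [TLetter.next] at h hv
    · rw [tribLetter_substLength, tribLetter_substLength_add_one] at h
      cases hul : tribLetter u <;> rw [hul] at h hu <;> simp [TLetter.next] at h hu
    · rw [tribLetter_substLength_add_one, tribLetter_substLength_add_one] at h
      have h := TLetter.next_injective h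
      have huv : u < v := substLength_strictMono.lt_iff_lt.1 (by omega)
      obtain ⟨n, i, j, hij, hne, hl, r, hr, e1, e2⟩ := lift u v huv (by omega) h
      refine ⟨n + 1, i, j, hij, hne, hl, substLength r + 1, ?_, ?_, ?_⟩
      · rw [palLength]
        exact Nat.succ_lt_succ (substLength_strictMono hr)
      · rw [← add_assoc, ← substLength_iterate_add _ _ hr.le, ← e1]
      · rw [← add_assoc, ← substLength_iterate_add _ _ hr.le, ← e2]

/-- `i` starts a maximal block of length one, that is, its letter differs from both neighbours. -/
def IsIsolated (i : ℕ) : Prop :=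
  tribLetter i ≠ tribLetter (i + 1) ∧ ∀ u, i = u + 1 → tribLetter u ≠ tribLetter i

instance : DecidablePred IsIsolated := fun i =>
  match i with
  | 0 => decidable_of_iff (tribLetter 0 ≠ tribLetter 1) (by simp [IsIsolated])
  | i + 1 => decidable_of_iff (tribLetter (i + 1) ≠ tribLetter (i + 2) ∧
      tribLetter i ≠ tribLetter (i + 1)) (by simp [IsIsolated])

lemma tribAux_succ_le_letterLength (n : ℕ) (x : TLetter) : tribAux (n + 1) ≤ letterLength n x := by
  have := tribAux_add_le n
  cases x <;> simp only [letterLength] <;> omega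

lemma letterLength_pos (n : ℕ) (x : TLetter) : 0 < letterLength n x :=
  (tribAux_succ_pos n).trans_le (tribAux_succ_le_letterLength n x)

lemma palLength_lt_add (n : ℕ) : palLength n < tribAux (n + 2) + tribAux (n + 1) := by
  have h := two_mul_palLength n
  have h1 := tribAux_add_three n
  have h2 := tribAux_add_le n
  omega

lemma eq_succ_of_iterate_sub_le {n i j : ℕ} (hij : i < j)
    (h : substLength^[n] j ≤ substLength^[n] i + palLength n) : j = i + 1 := by
  by_contra hne
  have hj : i + 1 + 1 ≤ j := by omega
  have hmono := (iterate_substLength_strictMono n).monotone hj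
  rw [iterate_substLength_succ, iterate_substLength_succ] at hmono
  have h1 := palLength_lt_add n
  have h2 := tribAux_succ_le_letterLength n (tribLetter i)
  have h3 := tribAux_succ_le_letterLength n (tribLetter (i + 1))
  by_cases hi : tribLetter i = .a
  · rw [hi] at hmono
    simp only [letterLength] at hmono h3
    omega
  · rw [tribLetter_succ_of_ne hi] at hmono
    simp only [letterLength] at hmono h2
    omega

lemma IsIsolated.maximalRun {i : ℕ} (hi : IsIsolated i) (n : ℕ) :
    MaximalRun (letterLength n (tribLetter i)) (substLength^[n] i) (palLength n) := by
  have h := maximalRun_iterate n i.lt_succ_self hi.1 (fun y d h1 h2 => by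
    obtain rfl : d = 1 := by omega
    rw [Agree, ← h1]
    exact hi.2 y h1)
  rwa [Nat.succ_eq_add_one, iterate_substLength_succ, Nat.add_sub_cancel_left] at h

lemma exists_isIsolated {p s : ℕ} (hp : 0 < p) (h : ∀ r < p, Agree p (s + r)) :
    ∃ n i r, IsIsolated i ∧ r + letterLength n (tribLetter i) ≤ palLength n ∧
      p = letterLength n (tribLetter i) ∧ s = substLength^[n] i + r := by
  obtain ⟨n, i, j, hij, hne, hl, r, hr, rfl, e2⟩ :=
    exists_iterate s (s + p) (by omega) (h 0 hp)
  have hmono := iterate_substLength_strictMono n hij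
  obtain rfl : p = substLength^[n] j - substLength^[n] i := by omega
  have hle := (maximalRun_iterate n hij hne hl).le_of_agree (by omega) h
  obtain rfl : j = i + 1 := eq_succ_of_iterate_sub_le (n := n) hij (by omega)
  rw [iterate_substLength_succ, Nat.add_sub_cancel_left] at hle ⊢
  exact ⟨n, i, r, ⟨hne, fun u hu => by simpa [Agree, ← hu] using hl u 1 hu (by omega)⟩, by omega,
    rfl, rfl⟩

lemma prefix_drop_letterPrefix_iff {w : List TLetter} {s N : ℕ} (h : s + 2 * w.length ≤ N) :
    w ++ w <+: (letterPrefix N).drop s ↔ w = (List.range w.length).map (fun r => tribLetter (s + r)) ∧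
      ∀ r < w.length, Agree w.length (s + r) := by
  have hget : ∀ k < 2 * w.length, ((letterPrefix N).drop s)[k]? = some (tribLetter (s + k)) := by
    intro k hk
    rw [List.getElem?_drop, letterPrefix_getElem? (by omega)]
  rw [List.prefix_iff_getElem?]
  constructor
  · intro hpre
    have h1 : ∀ r (hr : r < w.length), w[r] = tribLetter (s + r) := by
      intro r hr
      have := hpre r (by simp; omega)
      rw [hget r (by omega), List.getElem_append_left hr] at this
      exact (Option.some.inj this).symm
    refine ⟨List.ext_getElem (by simp) fun r hr _ => by simp [h1 r hr], fun r hr => ?_⟩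
    have := hpre (w.length + r) (by simp; omega)
    rw [hget _ (by omega), List.getElem_append_right (by omega)] at this
    simp only [Nat.add_sub_cancel_left, h1 r hr, Option.some.injEq] at this
    rw [Agree, ← this]
    congr 1
    omega
  · rintro ⟨hw, ha⟩ k hk
    have h1 : ∀ r (hr : r < w.length), w[r] = tribLetter (s + r) := by
      intro r hr
      conv_lhs => rw [List.getElem_of_eq hw]
      simp
    have hk' : k < w.length + w.length := by simpa using hk
    rw [hget k (by omega)]
    by_cases hkw : k < w.length
    · rw [List.getElem_append_left hkw, h1 k hkw]
    · have hag : tribLetter _ = tribLetter _ := ha (k - w.length) (by omega)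
      rw [List.getElem_append_right (by omega), h1 _ (by omega), hag]
      congr 2
      omega

lemma B_eq_ncard (N : ℕ) : B N = Set.ncard {q : ℕ × ℕ | 0 < q.1 ∧
    (∀ r < q.1, Agree q.1 (q.2 + r)) ∧ q.2 + 2 * q.1 ≤ N} := by
  let f : ℕ × ℕ → List TLetter × ℕ :=
    fun q => ((List.range q.1).map (fun r => tribLetter (q.2 + r)), q.2 + 1)
  have hf : Function.Injective f := by
    rintro ⟨p, s⟩ ⟨p', s'⟩ h
    have h1 := congrArg (fun x => x.1.length) h
    have h2 := congrArg Prod.snd h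
    simp [f] at h1 h2
    rw [h1, h2]
  rw [← Set.ncard_image_of_injective _ hf, B]
  change Set.ncard {p : List TLetter × ℕ | _} = _
  congr 1
  ext ⟨w, i⟩
  simp only [Set.mem_ofPred_eq, Set.mem_image, Prod.exists, f, Prod.mk.injEq, TPrefix_eq]
  constructor
  · rintro ⟨hw, hi, hN, hpre⟩
    have hpos := List.length_pos_iff.2 hw
    obtain ⟨h1, h2⟩ := (prefix_drop_letterPrefix_iff (by omega)).1 hpre
    exact ⟨w.length, i - 1, ⟨hpos, h2, by omega⟩, h1.symm, by omega⟩
  · rintro ⟨p, s, ⟨hp, ha, hN⟩, rfl, rfl⟩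
    refine ⟨?_, by omega, by simp; omega, ?_⟩
    · rw [← List.length_pos_iff]
      simpa using hp
    · rw [Nat.add_sub_cancel, prefix_drop_letterPrefix_iff (by simpa using hN)]
      simpa using ha

/-- The number of squares in the run coming from position `i` at level `n` that end within the
palindromic prefix of length `palLength m`. -/
def runCount (m n i : ℕ) : ℕ :=
  min (palLength n + 1 - letterLength n (tribLetter i))
    (palLength m + 1 - (substLength^[n] i + 2 * letterLength n (tribLetter i)))

lemma lt_runCount_iff {m n i r : ℕ} : r < runCount m n i ↔
    r + letterLength n (tribLetter i) ≤ palLength n ∧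
      substLength^[n] i + r + 2 * letterLength n (tribLetter i) ≤ palLength m := by
  rw [runCount, lt_min_iff]
  omega

lemma palLength_lt_of_lt {m n i : ℕ} (h : m < n) :
    palLength m < substLength^[n] i + 2 * letterLength n (tribLetter i) := by
  obtain ⟨n, rfl⟩ : ∃ k, n = k + 1 := ⟨n - 1, by omega⟩
  have h1 := palLength_strictMono.monotone (Nat.le_of_lt_succ h)
  have h2 := palLength_lt_add n
  have h3 := tribAux_add_le n
  have h4 := tribAux_le_two_mul n
  have h5 := tribAux_add_three n
  have h6 := tribAux_succ_pos n
  rcases Nat.eq_zero_or_pos i with rfl | hi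
  · simp [letterLength]
    simp only [add_assoc, Nat.reduceAdd] at *
    omega
  · have h7 := (iterate_substLength_strictMono (n + 1)).monotone hi
    rw [Nat.succ_eq_add_one, zero_add, iterate_substLength_one] at h7
    simp only [add_assoc, Nat.reduceAdd] at *
    omega

lemma B_palLength_eq_sum_runCount (m : ℕ) : B (palLength m) =
    ∑ n ∈ Finset.range (m + 1), ∑ i ∈ Finset.range (palLength m + 1) with IsIsolated i,
      runCount m n i := by
  let X : Finset (Σ _ : ℕ, Σ _ : ℕ, ℕ) := (Finset.range (m + 1)).sigma fun n =>
    ((Finset.range (palLength m + 1)).filter IsIsolated).sigma fun i =>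
      Finset.range (runCount m n i)
  let g : (Σ _ : ℕ, Σ _ : ℕ, ℕ) → ℕ × ℕ := fun x =>
    (letterLength x.1 (tribLetter x.2.1), substLength^[x.1] x.2.1 + x.2.2)
  have hX : X.card = ∑ n ∈ Finset.range (m + 1),
      ∑ i ∈ Finset.range (palLength m + 1) with IsIsolated i, runCount m n i := by
    simp [X, Finset.card_sigma]
  have hg : Set.InjOn g X := by
    rintro ⟨n, i, r⟩ hx ⟨n', i', r'⟩ hx' hgx
    simp only [X, Finset.coe_sigma, Set.mem_sigma_iff, Finset.mem_coe, Finset.mem_filter,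
      Finset.mem_range, lt_runCount_iff] at hx hx'
    simp only [g, Prod.mk.injEq] at hgx
    obtain ⟨hp, hs⟩ := hgx
    have hrun := hx.2.1.2.maximalRun n
    have hrun' := hx'.2.1.2.maximalRun n'
    rw [← hp] at hrun'
    have hpos := letterLength_pos n (tribLetter i)
    have hpos' := letterLength_pos n' (tribLetter i')
    obtain ⟨h1, h2⟩ := hrun.ext hrun' (y := substLength^[n] i + r) (by omega) (by omega)
      (by omega) (by omega)
    obtain rfl := palLength_strictMono.injective h2
    obtain rfl := (iterate_substLength_strictMono n).injective h1
    obtain rfl : r = r' := by omega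
    rfl
  rw [B_eq_ncard, ← hX, ← Finset.card_image_of_injOn hg, ← Set.ncard_coe_finset]
  congr 1
  ext ⟨p, s⟩
  simp only [Set.mem_ofPred_eq, Finset.coe_image, Set.mem_image, Finset.mem_coe, X,
    Finset.mem_sigma, Finset.mem_filter, Finset.mem_range, lt_runCount_iff, g, Prod.mk.injEq]
  constructor
  · rintro ⟨hp, ha, hN⟩
    obtain ⟨n, i, r, hi, hr, rfl, rfl⟩ := exists_isIsolated hp ha
    have hle : i ≤ substLength^[n] i := (iterate_substLength_strictMono n).le_apply
    refine ⟨⟨n, i, r⟩, ⟨?_, ⟨by dsimp only; omega, hi⟩, hr, hN⟩, rfl, rfl⟩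
    by_contra! hn
    dsimp only at hn
    have := palLength_lt_of_lt (m := m) (n := n) (i := i) (by omega)
    omega
  · rintro ⟨⟨n, i, r⟩, ⟨_, ⟨_, hi⟩, hr, hN⟩, rfl, rfl⟩
    refine ⟨letterLength_pos n _, fun q hq => ?_, hN⟩
    have := (hi.maximalRun n).agree (r + q) (by dsimp only at *; omega)
    rwa [← add_assoc] at this

lemma sum_isolated_eq_count (w : TLetter → ℕ) (N : ℕ) :
    ∑ i ∈ Finset.range N with IsIsolated i, w (tribLetter i) =
      Nat.count (fun i => tribLetter i = .a ∧ IsIsolated i) N * w .a +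
      Nat.count (fun i => tribLetter i = .b) N * w .b +
      Nat.count (fun i => tribLetter i = .c) N * w .c := by
  induction N with
  | zero => simp
  | succ N ih =>
    rw [Finset.sum_filter] at ih ⊢
    rw [Finset.sum_range_succ, ih, Nat.count_succ, Nat.count_succ, Nat.count_succ]
    have hiso : tribLetter N ≠ .a → IsIsolated N := by
      intro h
      refine ⟨by rw [tribLetter_succ_of_ne h]; exact h, fun u hu hT => ?_⟩
      rw [← hT] at h
      have := tribLetter_succ_of_ne h
      rw [← hu, ← hT] at this
      exact h this
    cases hN : tribLetter N with
    | a =>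
      by_cases h : IsIsolated N
      · simp [h]; ring
      · simp [h]
    | b => simp [hiso (by simp [hN])]; ring
    | c => simp [hiso (by simp [hN])]; ring

lemma isIsolated_substLength_succ_iff (N : ℕ) : IsIsolated (substLength (N + 1)) ↔
    tribLetter N ≠ .c ∧ tribLetter (N + 1) ≠ .c := by
  have hpos : 0 < substLength (N + 1) := N.succ_pos.trans_le substLength_strictMono.le_apply
  have h1 := tribLetter_substLength_succ_sub_one N
  rw [IsIsolated, tribLetter_substLength, tribLetter_substLength_add_one]
  constructor
  · rintro ⟨h2, h3⟩
    have h3 := h3 (substLength (N + 1) - 1) (by omega)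
    rw [h1] at h3
    constructor <;> rintro h <;> simp [h, TLetter.next] at h2 h3
  · rintro ⟨h2, h3⟩
    refine ⟨?_, fun u hu => ?_⟩
    · cases h : tribLetter (N + 1) <;> simp_all [TLetter.next]
    · rw [hu, Nat.add_sub_cancel] at h1
      rw [h1]
      cases h : tribLetter N <;> simp_all [TLetter.next]

/-- Passing to the image under the substitution in a prefix count. -/
lemma count_substLength_succ (P : ℕ → Prop) [DecidablePred P] (N : ℕ) :
    Nat.count P (substLength (N + 1) + 1) = Nat.count P (substLength N + 1) +
      (if tribLetter N ≠ .c ∧ P (substLength N + 1) then 1 else 0) +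
      (if P (substLength (N + 1)) then 1 else 0) := by
  rw [Nat.count_succ]
  by_cases h : tribLetter N = .c
  · simp [h, substLength_succ_of_eq h]
  · simp [h, substLength_succ_of_ne h, Nat.count_succ]

lemma count_a_substLength (N : ℕ) :
    Nat.count (fun i => tribLetter i = .a) (substLength N + 1) = N + 1 := by
  induction N with
  | zero => simp [Nat.count_succ]
  | succ N ih =>
    rw [count_substLength_succ, ih, tribLetter_substLength, tribLetter_substLength_add_one]
    cases tribLetter N <;> simp [TLetter.next]

lemma count_b_substLength (N : ℕ) :
    Nat.count (fun i => tribLetter i = .b) (substLength N + 1) =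
      Nat.count (fun i => tribLetter i = .a) N := by
  induction N with
  | zero => simp [Nat.count_succ]
  | succ N ih =>
    rw [count_substLength_succ, ih, tribLetter_substLength, tribLetter_substLength_add_one,
      Nat.count_succ]
    cases tribLetter N <;> simp [TLetter.next]

lemma count_c_substLength (N : ℕ) :
    Nat.count (fun i => tribLetter i = .c) (substLength N + 1) =
      Nat.count (fun i => tribLetter i = .b) N := by
  induction N with
  | zero => simp [Nat.count_succ]
  | succ N ih =>
    rw [count_substLength_succ, ih, tribLetter_substLength, tribLetter_substLength_add_one,
      Nat.count_succ]
    cases tribLetter N <;> simp [TLetter.next]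

lemma count_isolated_substLength (N : ℕ) :
    Nat.count (fun i => tribLetter i = .a ∧ IsIsolated i) (substLength N + 1) +
      2 * Nat.count (fun i => tribLetter i = .c) N + (if tribLetter N = .c then 1 else 0) =
        N + 1 := by
  induction N with
  | zero =>
    have : IsIsolated 0 := by decide
    simp [Nat.count_succ, this]
  | succ N ih =>
    rw [count_substLength_succ, Nat.count_succ (fun i => tribLetter i = .c),
      tribLetter_substLength_add_one]
    simp only [isIsolated_substLength_succ_iff, tribLetter_substLength]
    have hsucc := tribLetter_succ_of_ne (x := N)
    cases hN : tribLetter N <;> simp [hN, TLetter.next] at ih hsucc ⊢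
    · by_cases h : tribLetter (N + 1) = .c <;> simp [h] <;> omega
    · simp [hsucc]; omega
    · simp [hsucc]; omega

lemma tribAux_le_palLength_add_one (n : ℕ) : tribAux (n + 2) ≤ palLength n + 1 := by
  cases n with
  | zero => simp [tribAux]
  | succ n =>
    have h := two_mul_palLength (n + 1)
    have h1 := tribAux_add_three (n + 1)
    have h2 := tribAux_add_three n
    have h3 := tribAux_add_le n
    have h4 := tribAux_succ_pos n
    simp only [add_assoc, Nat.reduceAdd] at *
    omega

lemma runCount_of_lt {n k i : ℕ} (hi : i < palLength k) :
    runCount (n + k) n i = palLength n + 1 - letterLength n (tribLetter i) := by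
  have h := (iterate_substLength_strictMono n).monotone (Nat.succ_le_of_lt hi)
  rw [Nat.succ_eq_add_one, iterate_substLength_succ] at h
  rw [runCount, palLength_add]
  omega

lemma palLength_lt_of_palLength_lt {n k i : ℕ} (hi : palLength k < i) :
    palLength (n + k) < substLength^[n] i + 2 * letterLength n (tribLetter i) := by
  obtain ⟨i, rfl⟩ : ∃ j, i = j + 1 := ⟨i - 1, by omega⟩
  have h := (iterate_substLength_strictMono n).monotone (Nat.le_of_lt_succ hi)
  have h1 := palLength_lt_add n
  have h2 := tribAux_succ_le_letterLength n (tribLetter i)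
  have h3 := tribAux_succ_le_letterLength n (tribLetter (i + 1))
  have h4 : letterLength n .a = tribAux (n + 2) := rfl
  rw [palLength_add, iterate_substLength_succ]
  by_cases hi : tribLetter i = .a
  · rw [hi] at h2 ⊢
    omega
  · rw [tribLetter_succ_of_ne hi] at h3 ⊢
    omega

lemma runCount_palLength (n k : ℕ) :
    (if IsIsolated (palLength k) then runCount (n + k) n (palLength k) else 0) =
      if tribLetter (palLength k) = .c then palLength n + 1 - 2 * tribAux (n + 1) else 0 := by
  have h1 := two_mul_palLength n
  have h2 := tribAux_add_three n
  have h3 := tribAux_le_two_mul n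
  have h4 := tribAux_add_le n
  have h5 := tribAux_succ_pos n
  cases hk : tribLetter (palLength k) with
  | a =>
    simp only [runCount, palLength_add, hk, letterLength, reduceCtorEq, if_false]
    split_ifs <;> omega
  | b =>
    simp only [runCount, palLength_add, hk, letterLength, reduceCtorEq, if_false]
    split_ifs <;> omega
  | c =>
    have hiso : IsIsolated (palLength k) := by
      refine ⟨by rw [tribLetter_succ_of_ne (by simp [hk])]; simp [hk], fun u hu h => ?_⟩
      have := tribLetter_succ_of_ne (x := u) (by simp [h, hk])
      rw [← hu, hk] at this
      cases this
    simp only [runCount, palLength_add, hk, letterLength, hiso, if_true]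
    omega

lemma sum_runCount (n k : ℕ) :
    ∑ i ∈ Finset.range (palLength (n + k) + 1) with IsIsolated i, runCount (n + k) n i =
      Nat.count (fun i => tribLetter i = .a ∧ IsIsolated i) (palLength k) *
        (palLength n + 1 - letterLength n .a) +
      Nat.count (fun i => tribLetter i = .b) (palLength k) *
        (palLength n + 1 - letterLength n .b) +
      Nat.count (fun i => tribLetter i = .c) (palLength k) *
        (palLength n + 1 - letterLength n .c) +
      if tribLetter (palLength k) = .c then palLength n + 1 - 2 * tribAux (n + 1) else 0 := by
  have hle : palLength k ≤ palLength (n + k) := palLength_strictMono.monotone (by omega)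
  rw [← sum_isolated_eq_count (fun x => palLength n + 1 - letterLength n x),
    ← runCount_palLength, Finset.sum_filter, Finset.sum_filter,
    ← Finset.sum_subset (Finset.range_mono (Nat.succ_le_succ hle)), Finset.sum_range_succ]
  · congr 1
    refine Finset.sum_congr rfl fun i hi => ?_
    rw [runCount_of_lt (Finset.mem_range.1 hi)]
  · intro i _ hi
    have := palLength_lt_of_palLength_lt (n := n) (k := k) (i := i) (by simpa using hi)
    rw [runCount]
    split_ifs <;> omega

lemma count_a_palLength (k : ℕ) :
    2 * Nat.count (fun i => tribLetter i = .a) (palLength k) + 1 = tribAux (k + 2) + tribAux k := by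
  cases k with
  | zero => simp [palLength, tribAux]
  | succ k =>
    rw [palLength, count_a_substLength]
    have := two_mul_palLength k
    simp only [add_assoc, Nat.reduceAdd] at *
    omega

lemma count_c_palLength (k : ℕ) :
    2 * Nat.count (fun i => tribLetter i = .c) (palLength k) + 1 + tribAux (k + 2) =
      2 * tribAux (k + 1) + tribAux k := by
  match k with
  | 0 => simp [palLength, tribAux]
  | 1 => simp [palLength, tribAux, Nat.count_succ]
  | k + 2 =>
    rw [palLength, count_c_substLength, palLength, count_b_substLength]
    have h := count_a_palLength k
    have h1 := tribAux_add_three (k + 1)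
    have h2 := tribAux_add_three k
    simp only [add_assoc, Nat.reduceAdd] at *
    omega

/-- The number of squares ending in a palindromic prefix as a convolution. -/
lemma B_palLength_succ (m : ℕ) : (B (palLength (m + 1)) : ℚ) =
    ∑ p ∈ Finset.HasAntidiagonal.antidiagonal m,
      ((palLength p.1 + 1 - tribAux (p.1 + 2)) *
          (palLength p.2 + 1 - 2 * Nat.count (fun i => tribLetter i = .c) (palLength p.2)) +
        (palLength p.1 + 1 - tribAux (p.1 + 1) - tribAux p.1) *
          Nat.count (fun i => tribLetter i = .a) (palLength p.2) +
        (palLength p.1 + 1) * Nat.count (fun i => tribLetter i = .c) (palLength p.2) : ℚ) := by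
  have h : B (palLength (m + 1)) = ∑ p ∈ Finset.HasAntidiagonal.antidiagonal (m + 1),
      (Nat.count (fun i => tribLetter i = .a ∧ IsIsolated i) (palLength p.2) *
        (palLength p.1 + 1 - letterLength p.1 .a) +
      Nat.count (fun i => tribLetter i = .b) (palLength p.2) *
        (palLength p.1 + 1 - letterLength p.1 .b) +
      Nat.count (fun i => tribLetter i = .c) (palLength p.2) *
        (palLength p.1 + 1 - letterLength p.1 .c) +
      if tribLetter (palLength p.2) = .c then palLength p.1 + 1 - 2 * tribAux (p.1 + 1) else 0) := by
    rw [B_palLength_eq_sum_runCount, ← Nat.succ_eq_add_one,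
      ← Finset.Nat.sum_antidiagonal_eq_sum_range_succ_mk (fun p : ℕ × ℕ =>
        ∑ i ∈ Finset.range (palLength (m + 1) + 1) with IsIsolated i, runCount (m + 1) p.1 i)]
    refine Finset.sum_congr rfl fun p hp => ?_
    rw [← sum_runCount, Finset.HasAntidiagonal.mem_antidiagonal.1 hp]
  rw [h, Finset.sum_add_distrib, Finset.sum_add_distrib, Finset.sum_add_distrib,
    Finset.Nat.sum_antidiagonal_succ', Finset.Nat.sum_antidiagonal_succ',
    Finset.Nat.sum_antidiagonal_succ, Finset.Nat.sum_antidiagonal_succ]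
  simp only [palLength, Nat.count_zero, zero_mul, zero_add, letterLength, tribAux, mul_one,
    Nat.reduceSub, mul_zero, ite_self, Nat.sub_self]
  rw [← Finset.sum_add_distrib, ← Finset.sum_add_distrib, ← Finset.sum_add_distrib, Nat.cast_sum]
  refine Finset.sum_congr rfl fun p _ => ?_
  obtain ⟨n, k⟩ := p
  have h1 := tribAux_le_palLength_add_one n
  have h2 := tribAux_add_le n
  have h3 := palLength_succ n
  have h4 := count_isolated_substLength (palLength k)
  dsimp only
  rw [palLength] at h3
  rw [count_b_substLength, h3,
    show palLength n + tribAux (n + 2) + 1 - tribAux (n + 1 + 1) = palLength n + 1 by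
      rw [add_assoc n, one_add_one_eq_two]; omega,
    show palLength n + tribAux (n + 2) + 1 - 2 * tribAux (n + 1 + 1) =
      palLength n + 1 - tribAux (n + 2) by rw [add_assoc n, one_add_one_eq_two]; omega]
  have h4' : (Nat.count (fun i => tribLetter i = .a ∧ IsIsolated i)
      (substLength (palLength k) + 1) : ℚ) = palLength k + 1 -
      2 * Nat.count (fun i => tribLetter i = .c) (palLength k) -
      (if tribLetter (palLength k) = .c then 1 else 0) := by
    rw [eq_sub_iff_add_eq, eq_sub_iff_add_eq]
    have := congrArg (Nat.cast (R := ℚ)) h4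
    push_cast at this
    linarith
  push_cast [Nat.cast_sub h1, Nat.cast_sub (h2.trans h1), h4']
  split_ifs <;> ring

/-- The convolution of two shifts of the Tribonacci sequence. -/
def tribConv (i j m : ℕ) : ℚ :=
  ∑ p ∈ Finset.HasAntidiagonal.antidiagonal m, (tribAux (p.1 + i) : ℚ) * tribAux (p.2 + j)

lemma tribAux_cast_add_three (n : ℕ) : (tribAux (n + 3) : ℚ) =
    tribAux (n + 2) + tribAux (n + 1) + tribAux n := by
  rw [tribAux_add_three]
  push_cast
  ring

lemma tribConv_succ_left (i j m : ℕ) : tribConv i j (m + 1) =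
    tribAux i * tribAux (m + 1 + j) + tribConv (i + 1) j m := by
  rw [tribConv, Finset.Nat.sum_antidiagonal_succ, zero_add, tribConv]
  simp only [add_assoc, add_comm 1 i]

lemma tribConv_succ_right (i j m : ℕ) : tribConv i j (m + 1) =
    tribAux (m + 1 + i) * tribAux j + tribConv i (j + 1) m := by
  rw [tribConv, Finset.Nat.sum_antidiagonal_succ', zero_add, tribConv]
  simp only [add_assoc, add_comm 1 j]

lemma tribConv_add_three (i j m : ℕ) : tribConv (i + 3) j m =
    tribConv (i + 2) j m + tribConv (i + 1) j m + tribConv i j m := by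
  simp only [tribConv, ← Finset.sum_add_distrib, ← add_mul, ← add_assoc, tribAux_cast_add_three]

lemma tribConv_closed (m : ℕ) :
    22 * tribConv 0 0 m = -8 * tribAux m - 5 * tribAux (m + 1) + 5 * tribAux (m + 2) +
      m * (-4 * tribAux m - 3 * tribAux (m + 1) + 5 * tribAux (m + 2)) ∧
    22 * tribConv 1 0 m = 10 * tribAux m - 2 * tribAux (m + 1) + 2 * tribAux (m + 2) +
      m * (5 * tribAux m + tribAux (m + 1) + 2 * tribAux (m + 2)) ∧
    22 * tribConv 2 0 m = 4 * tribAux m - 3 * tribAux (m + 1) + 3 * tribAux (m + 2) +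
      m * (2 * tribAux m + 7 * tribAux (m + 1) + 3 * tribAux (m + 2)) := by
  induction m with
  | zero => simp [tribConv, tribAux]
  | succ m ih =>
    obtain ⟨h0, h1, h2⟩ := ih
    have h3 := tribConv_add_three 0 0 m
    have h := tribAux_cast_add_three m
    have e0 : tribAux 0 = 0 := rfl
    have e1 : tribAux 1 = 1 := rfl
    have e2 : tribAux 2 = 1 := rfl
    simp only [tribConv_succ_left, add_assoc, Nat.reduceAdd, zero_add, add_zero, Nat.cast_add,
      Nat.cast_one, e0, e1, e2, h, Nat.cast_zero] at *
    refine ⟨?_, ?_, ?_⟩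
    · linear_combination h1
    · linear_combination h2
    · linear_combination h0 + h1 + h2 + 22 * h3

lemma sum_tribAux_fst (i m : ℕ) :
    2 * ∑ p ∈ Finset.HasAntidiagonal.antidiagonal m, (tribAux (p.1 + i) : ℚ) =
      tribAux (m + i + 2) + tribAux (m + i) - tribAux (i + 2) + tribAux i := by
  induction m with
  | zero => simp; ring
  | succ m ih =>
    rw [Finset.Nat.sum_antidiagonal_succ', mul_add, ih]
    have := tribAux_cast_add_three (m + i)
    simp only [show m + 1 + i = m + i + 1 by omega, add_assoc, Nat.reduceAdd] at *
    linear_combination -this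

lemma sum_tribAux_snd (i m : ℕ) :
    2 * ∑ p ∈ Finset.HasAntidiagonal.antidiagonal m, (tribAux (p.2 + i) : ℚ) =
      tribAux (m + i + 2) + tribAux (m + i) - tribAux (i + 2) + tribAux i := by
  rw [← sum_tribAux_fst, ← Finset.Nat.sum_antidiagonal_swap]
  rfl

lemma B_palLength_eq_tribConv (m : ℕ) : 4 * (B (palLength (m + 1)) : ℚ) =
    4 * tribConv 1 2 m + tribConv 0 2 m - tribConv 0 0 m - 3 * tribConv 2 2 m +
      4 * tribConv 2 1 m + 3 * tribConv 2 0 m - 3 * (tribAux (m + 4) + tribAux (m + 2) - 3) +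
      m + 1 := by
  have h0 := sum_tribAux_fst 0 m
  have h1 := sum_tribAux_fst 2 m
  have h2 := sum_tribAux_snd 2 m
  have h3 := sum_tribAux_snd 0 m
  have hc : ∑ p ∈ Finset.HasAntidiagonal.antidiagonal m, (1 : ℚ) = m + 1 := by simp
  have key : 4 * (B (palLength (m + 1)) : ℚ) =
      4 * tribConv 1 2 m + tribConv 0 2 m - tribConv 0 0 m - 3 * tribConv 2 2 m +
      4 * tribConv 2 1 m + 3 * tribConv 2 0 m +
      ∑ p ∈ Finset.HasAntidiagonal.antidiagonal m, (tribAux (p.1 + 0) : ℚ) -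
      3 * ∑ p ∈ Finset.HasAntidiagonal.antidiagonal m, (tribAux (p.1 + 2) : ℚ) -
      3 * ∑ p ∈ Finset.HasAntidiagonal.antidiagonal m, (tribAux (p.2 + 2) : ℚ) -
      ∑ p ∈ Finset.HasAntidiagonal.antidiagonal m, (tribAux (p.2 + 0) : ℚ) +
      ∑ p ∈ Finset.HasAntidiagonal.antidiagonal m, (1 : ℚ) := by
    rw [B_palLength_succ]
    simp only [tribConv, Finset.mul_sum, ← Finset.sum_add_distrib, ← Finset.sum_sub_distrib]
    refine Finset.sum_congr rfl fun p _ => ?_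
    obtain ⟨n, k⟩ := p
    have e1 := congrArg (Nat.cast (R := ℚ)) (two_mul_palLength n)
    have e2 := congrArg (Nat.cast (R := ℚ)) (two_mul_palLength k)
    have e3 := congrArg (Nat.cast (R := ℚ)) (count_a_palLength k)
    have e4 := congrArg (Nat.cast (R := ℚ)) (count_c_palLength k)
    have e5 := tribAux_cast_add_three n
    have e6 := tribAux_cast_add_three k
    push_cast at e1 e2 e3 e4
    rw [e5] at e1
    rw [e6] at e2
    have e1 : (palLength n : ℚ) =
        (tribAux (n + 2) + 2 * tribAux (n + 1) + tribAux n - 3) / 2 := by linarith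
    have e2 : (palLength k : ℚ) =
        (tribAux (k + 2) + 2 * tribAux (k + 1) + tribAux k - 3) / 2 := by linarith
    have e3 : (Nat.count (fun i => tribLetter i = .a) (palLength k) : ℚ) =
        (tribAux (k + 2) + tribAux k - 1) / 2 := by linarith
    have e4 : (Nat.count (fun i => tribLetter i = .c) (palLength k) : ℚ) =
        (2 * tribAux (k + 1) + tribAux k - tribAux (k + 2) - 1) / 2 := by linarith
    dsimp only
    rw [e1, e2, e3, e4, add_zero, add_zero]
    ring
  rw [key, hc]
  have d0 : tribAux 0 = 0 := rfl
  have d2 : tribAux 2 = 1 := rfl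
  have d4 : tribAux 4 = 4 := rfl
  simp only [add_assoc, Nat.reduceAdd, add_zero, zero_add, d0, d2, d4] at *
  push_cast at *
  linarith

lemma B_palLength_closed (m : ℕ) : 44 * (B (palLength (m + 1)) : ℚ) =
    6 * tribAux m - 32 * tribAux (m + 1) - 78 * tribAux (m + 2) +
      m * (3 * tribAux m + 16 * tribAux (m + 1) + 21 * tribAux (m + 2)) + 110 + 11 * m := by
  obtain ⟨c00, -, c20⟩ := tribConv_closed m
  obtain ⟨-, -, d20⟩ := tribConv_closed (m + 1)
  obtain ⟨e00, e10, e20⟩ := tribConv_closed (m + 2)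
  have r2 (i : ℕ) : tribConv i 0 (m + 2) = tribAux (m + 1 + i) + tribConv i 2 m := by
    rw [tribConv_succ_right, tribConv_succ_right]
    simp [tribAux]
  have r1 : tribConv 2 0 (m + 1) = tribConv 2 1 m := by
    rw [tribConv_succ_right]
    simp [tribAux]
  have t0 := tribAux_cast_add_three m
  have t1 := tribAux_cast_add_three (m + 1)
  rw [r2] at e00 e10 e20
  rw [r1] at d20
  have h := B_palLength_eq_tribConv m
  push_cast at *
  simp only [add_assoc, Nat.reduceAdd, add_zero] at *
  simp only [t1, t0] at *
  linear_combination 11 * h + 2 * e10 + e00 / 2 - c00 / 2 - 3 / 2 * e20 + 2 * d20 + 3 / 2 * c20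

theorem repeated_squares_block_sum (m : ℤ) (hm : 4 ≤ m) :
    (B ((t m + 2 * t (m - 1) + t (m - 2) - 3) / 2) : ℚ) -
      (B ((t m + t (m - 2) - 3) / 2) : ℚ) =
    (m : ℚ) / 22 * (-5 * (t m : ℚ) + 14 * (t (m - 1) : ℚ) + 4 * (t (m - 2) : ℚ)) +
      1 / 44 * (67 * (t m : ℚ) - 166 * (t (m - 1) : ℚ) + 5 * (t (m - 2) : ℚ)) + 1 / 4 := by
  obtain ⟨n, rfl⟩ : ∃ n : ℕ, m = n + 4 := ⟨(m - 4).toNat, by omega⟩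
  have e0 : t (n + 4) = tribAux (n + 6) := by rw [t]; congr 1
  have e1 : t (n + 4 - 1) = tribAux (n + 5) := by rw [t]; congr 1; omega
  have e2 : t (n + 4 - 2) = tribAux (n + 4) := by rw [t]; congr 1; omega
  have p0 := two_mul_palLength (n + 3)
  have p1 := two_mul_palLength (n + 4)
  have t4 := tribAux_add_three (n + 4)
  simp only [add_assoc, Nat.reduceAdd] at p0 p1 t4
  have s0 : (tribAux (n + 6) + tribAux (n + 4) - 3) / 2 = palLength (n + 3) := by omega
  have s1 : (tribAux (n + 6) + 2 * tribAux (n + 5) + tribAux (n + 4) - 3) / 2 =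
      palLength (n + 4) := by omega
  rw [e0, e1, e2, s0, s1]
  have h0 := B_palLength_closed (n + 2)
  have h1 := B_palLength_closed (n + 3)
  have r2 := tribAux_cast_add_three (n + 2)
  have r3 := tribAux_cast_add_three (n + 3)
  push_cast at *
  simp only [add_assoc, Nat.reduceAdd] at *
  simp only [r3, r2] at *
  linear_combination h1 / 44 - h0 / 44
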